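/- Let a, b, c, μ ∈ ℂ with Re(c-a) > Re μ > 0 and Re(c-b) > Re μ > 0, and assume neither c nor c−μ is a nonpositive integer. Then for every real x < 1, one has ∫_{-∞}^{x} (1-y)^{a+b-c} F(a,b;c;y) · (x-y)^{μ-1}/Γ(μ) dy = (Γ(c-a-μ)/Γ(c-a)) · (Γ(c-b-μ)/Γ(c-b)) · (Γ(c)/Γ(c-μ)) · (1-x)^{a+b-c+μ} · F(a,b;c-μ;x) (fractional integral transformation of type c−). -/

import Mathlib

open MeasureTheory Set Complex Filter

/-- Pochhammer symbol `(a)_k = a (a+1) ⋯ (a+k-1)`. -/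
noncomputable def poch (a : ℂ) (k : ℕ) : ℂ := ∏ i ∈ Finset.range k, (a + i)

/-- The Gauss hypergeometric function `F(a,b;c;x)` for real `x < 1`, defined by the
power series on `[0,1)` and by the (agreeing) Pfaff series for `x < 0`. -/
noncomputable def hypF (a b c : ℂ) (x : ℝ) : ℂ :=
  if 0 ≤ x then
    ∑' k : ℕ, poch a k * poch b k / (poch c k * (Nat.factorial k : ℂ)) * (x : ℂ) ^ k
  else
    ((1 - x : ℝ) : ℂ) ^ (-a) *
      ∑' k : ℕ, poch a k * poch (c - b) k / (poch c k * (Nat.factorial k : ℂ)) *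
        (((x / (x - 1) : ℝ)) : ℂ) ^ k

open scoped Topology

lemma poch_zero (s : ℂ) : poch s 0 = 1 := by simp [poch]

lemma poch_succ (s : ℂ) (k : ℕ) : poch s (k + 1) = poch s k * (s + k) := by
  simp [poch, Finset.prod_range_succ]

lemma poch_add (s : ℂ) (n m : ℕ) : poch s (n + m) = poch s n * poch (s + n) m := by
  induction m with
  | zero => simp [poch_zero]
  | succ m ih => rw [← add_assoc, poch_succ, ih, poch_succ]; push_cast; ring

lemma poch_succ' (s : ℂ) (k : ℕ) : poch s (k + 1) = s * poch (s + 1) k := by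
  rw [add_comm k 1, poch_add]; simp [poch]

lemma poch_ne_zero {s : ℂ} (hs : ∀ n : ℕ, s ≠ -(n : ℂ)) (k : ℕ) : poch s k ≠ 0 := by
  rw [poch, Finset.prod_ne_zero_iff]
  intro i _ h
  exact hs i (eq_neg_of_add_eq_zero_left h)

lemma poch_one (k : ℕ) : poch 1 k = (k.factorial : ℂ) := by
  induction k with
  | zero => simp [poch_zero]
  | succ k ih => rw [poch_succ, ih, Nat.factorial_succ]; push_cast; ring

lemma nonpole_add {s : ℂ} (hs : ∀ n : ℕ, s ≠ -(n : ℂ)) (m : ℕ) : ∀ n : ℕ, s + m ≠ -(n : ℂ) := by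
  intro n h
  apply hs (m + n)
  push_cast
  linear_combination h

lemma nonpole_of_re {s : ℂ} (hs : 0 < s.re) : ∀ n : ℕ, s ≠ -(n : ℂ) := by
  intro n h
  rw [h] at hs
  simp at hs
  have : (0:ℝ) ≤ n := n.cast_nonneg
  linarith

lemma Gamma_add_nat {s : ℂ} (hs : ∀ n : ℕ, s ≠ -(n : ℂ)) (k : ℕ) :
    Gamma (s + k) = poch s k * Gamma s := by
  induction k with
  | zero => simp [poch_zero]
  | succ k ih =>
    have h : s + k ≠ 0 := by
      intro h; exact hs k (eq_neg_of_add_eq_zero_left h)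
    rw [poch_succ]
    push_cast
    rw [← add_assoc, Gamma_add_one _ h, ih]; ring

/-- hypergeometric coefficient -/
noncomputable def cf (a b c : ℂ) (k : ℕ) : ℂ :=
  poch a k * poch b k / (poch c k * (Nat.factorial k : ℂ))

/-- real binomial coefficient `(q)_k / k!` -/
noncomputable def pq (q : ℝ) (k : ℕ) : ℝ := (∏ i ∈ Finset.range k, (q + i)) / (k.factorial : ℝ)

lemma pq_ofReal (q : ℝ) (k : ℕ) : ((pq q k : ℝ) : ℂ) = poch q k / (k.factorial : ℂ) := by
  simp [pq, poch]

lemma pq_pos {q : ℝ} (hq : 0 < q) (k : ℕ) : 0 < pq q k := by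
  unfold pq
  apply div_pos
  · apply Finset.prod_pos
    intro i _
    positivity
  · positivity

lemma poch_eq_asc (s : ℂ) (k : ℕ) : (ascPochhammer ℂ k).eval s = poch s k := by
  induction k with
  | zero => simp [poch_zero]
  | succ k ih => rw [ascPochhammer_succ_eval, ih, poch_succ]

lemma choose_eq_poch (s : ℂ) (k : ℕ) :
    Ring.choose (s + k - 1) k = poch s k / (k.factorial : ℂ) := by
  have h := Ring.factorial_nsmul_multichoose_eq_ascPochhammer s k
  rw [Polynomial.ascPochhammer_smeval_eq_eval, poch_eq_asc] at h
  have h2 : Ring.choose (s + k - 1) k = Ring.multichoose s k := by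
    rw [Ring.choose]; congr 1; ring
  rw [h2, ← h]
  have : (k.factorial : ℂ) ≠ 0 := by exact_mod_cast k.factorial_ne_zero
  rw [nsmul_eq_mul]
  field_simp

lemma binom_hasSum (s y : ℂ) (hy : ‖y‖ < 1) :
    HasSum (fun k : ℕ => poch s k / (k.factorial : ℂ) * y ^ k) ((1 - y) ^ (-s)) := by
  have h := (one_div_one_sub_cpow_hasFPowerSeriesOnBall_zero s).hasSum (y := y) (by simpa [enorm_eq_nnnorm, ← NNReal.coe_lt_coe] using hy)
  simp only [FormalMultilinearSeries.ofScalars_apply_eq, zero_add, smul_eq_mul, choose_eq_poch] at h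
  rw [cpow_neg, ← one_div]
  exact h

lemma pq_hasSum (q r : ℝ) (h0 : 0 ≤ r) (h1 : r < 1) :
    HasSum (fun k : ℕ => pq q k * r ^ k) ((1 - r) ^ (-q)) := by
  have h := binom_hasSum q r (by simpa [abs_of_nonneg h0] using h1)
  rw [← Complex.hasSum_ofReal]
  push_cast
  simp only [pq_ofReal]
  convert h using 1
  rw [ofReal_cpow (by linarith)]
  push_cast; rfl

lemma GS_poch (s : ℂ) {n : ℕ} (hn : n ≠ 0) :
    poch s (n + 1) = (n : ℂ) ^ s * (n.factorial : ℂ) * (GammaSeq s n)⁻¹ := by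
  have h1 : (n : ℂ) ^ s ≠ 0 := by
    rw [Ne, cpow_eq_zero_iff]; simp [hn]
  have h2 : (n.factorial : ℂ) ≠ 0 := by exact_mod_cast n.factorial_ne_zero
  rw [GammaSeq, poch, inv_div]
  field_simp

lemma GS_bdd (s : ℂ) : ∃ C : ℝ, 0 < C ∧ ∀ n, ‖GammaSeq s n‖ ≤ C := by
  obtain ⟨C, hC⟩ := (GammaSeq_tendsto_Gamma s).norm.bddAbove_range
  exact ⟨max C 1, by positivity, fun n => (hC ⟨n, rfl⟩).trans (le_max_left _ _)⟩

lemma GS_inv_bdd (s : ℂ) : ∃ C : ℝ, 0 < C ∧ ∀ n, ‖(GammaSeq s n)⁻¹‖ ≤ C := by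
  have : ∃ l, Tendsto (fun n => (GammaSeq s n)⁻¹) atTop (𝓝 l) := by
    by_cases h : ∀ n : ℕ, s ≠ -(n : ℂ)
    · exact ⟨_, (GammaSeq_tendsto_Gamma s).inv₀ (Gamma_ne_zero h)⟩
    · push Not at h
      obtain ⟨m, hm⟩ := h
      refine ⟨0, tendsto_const_nhds.congr' ?_⟩
      filter_upwards [eventually_ge_atTop m] with n hn
      rw [GammaSeq, Finset.prod_eq_zero (i := m)]
      · simp
      · simp; omega
      · rw [hm]; ring
  obtain ⟨l, hl⟩ := this
  obtain ⟨C, hC⟩ := hl.norm.bddAbove_range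
  exact ⟨max C 1, by positivity, fun n => (hC ⟨n, rfl⟩).trans (le_max_left _ _)⟩

lemma cf_bound (a b c : ℂ) : ∃ C : ℝ, 0 < C ∧ ∀ n : ℕ, n ≠ 0 →
    ‖cf a b c (n + 1)‖ ≤ C * ((n : ℝ) ^ (a + b - c).re / (n + 1)) := by
  obtain ⟨A, hA, hA'⟩ := GS_inv_bdd a
  obtain ⟨B, hB, hB'⟩ := GS_inv_bdd b
  obtain ⟨D, hD, hD'⟩ := GS_bdd c
  refine ⟨A * B * D, by positivity, fun n hn => ?_⟩
  have hn' : (n : ℂ) ≠ 0 := by exact_mod_cast hn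
  have hnr : (0 : ℝ) < n := by positivity
  have h2 : (n.factorial : ℂ) ≠ 0 := by exact_mod_cast n.factorial_ne_zero
  have h3 : (n : ℂ) ^ c ≠ 0 := by
    rw [Ne, cpow_eq_zero_iff]; simp [hn]
  have h4 : (n : ℂ) + 1 ≠ 0 := by exact_mod_cast n.succ_ne_zero
  have key : cf a b c (n + 1) = (GammaSeq a n)⁻¹ * (GammaSeq b n)⁻¹ * GammaSeq c n *
      ((n : ℂ) ^ (a + b - c) / (n + 1)) := by
    rw [cf, GS_poch a hn, GS_poch b hn, GS_poch c hn, cpow_sub _ _ hn', cpow_add _ _ hn',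
      Nat.factorial_succ]
    push_cast
    field_simp
  rw [key, norm_mul, norm_mul, norm_mul, norm_div]
  have h5 : ‖(n : ℂ) ^ (a + b - c)‖ = (n : ℝ) ^ (a + b - c).re := by
    have := norm_cpow_eq_rpow_re_of_pos hnr (a + b - c)
    simpa using this
  have h6 : ‖(n : ℂ) + 1‖ = n + 1 := by
    have : (n : ℂ) + 1 = ((n + 1 : ℝ) : ℂ) := by push_cast; rfl
    rw [this, norm_real, Real.norm_of_nonneg (by positivity)]
  rw [h5, h6]
  gcongr
  · exact hA' n
  · exact hB' n
  · exact hD' n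

lemma pq_lower {q : ℝ} (hq : 0 < q) : ∃ C : ℝ, 0 < C ∧ ∀ n : ℕ, n ≠ 0 →
    (n : ℝ) ^ q / (n + 1) ≤ C * pq q (n + 1) := by
  obtain ⟨D, hD, hD'⟩ := GS_bdd q
  refine ⟨D, hD, fun n hn => ?_⟩
  have hnr : (0 : ℝ) < n := by positivity
  have h2 : (n.factorial : ℂ) ≠ 0 := by exact_mod_cast n.factorial_ne_zero
  have h4 : (n : ℂ) + 1 ≠ 0 := by exact_mod_cast n.succ_ne_zero
  have hpn : poch q (n + 1) ≠ 0 := poch_ne_zero (nonpole_of_re (by simpa using hq)) _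
  have key : ((pq q (n + 1) : ℝ) : ℂ) * GammaSeq q n = (n : ℂ) ^ (q : ℂ) / (n + 1) := by
    rw [pq_ofReal, GammaSeq, ← poch, Nat.factorial_succ]
    push_cast
    field_simp
  have h := congrArg norm key
  rw [norm_mul, norm_real, Real.norm_of_nonneg (pq_pos hq _).le, norm_div] at h
  have h5 : ‖(n : ℂ) ^ (q : ℂ)‖ = (n : ℝ) ^ q := by
    have := norm_cpow_eq_rpow_re_of_pos hnr q
    simpa using this
  have h6 : ‖(n : ℂ) + 1‖ = n + 1 := by
    have : (n : ℂ) + 1 = ((n + 1 : ℝ) : ℂ) := by push_cast; rfl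
    rw [this, norm_real, Real.norm_of_nonneg (by positivity)]
  rw [h5, h6] at h
  rw [← h, mul_comm]
  gcongr
  · exact (pq_pos hq _).le
  · exact hD' n

lemma cf_le_pq (a b c : ℂ) {q : ℝ} (hq : 0 < q) (h : (a + b - c).re ≤ q) :
    ∃ C : ℝ, 0 < C ∧ ∀ k : ℕ, ‖cf a b c k‖ ≤ C * pq q k := by
  obtain ⟨C, hC, hC'⟩ := cf_bound a b c
  obtain ⟨D, hD, hD'⟩ := pq_lower hq
  have p0 := pq_pos hq 0
  have p1 := pq_pos hq 1
  refine ⟨C * D + ‖cf a b c 0‖ / pq q 0 + ‖cf a b c 1‖ / pq q 1, by positivity, fun k => ?_⟩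
  have pk := pq_pos hq k
  match k with
  | 0 =>
    have : ‖cf a b c 0‖ = ‖cf a b c 0‖ / pq q 0 * pq q 0 := by field_simp
    rw [add_mul, add_mul, ← this]
    have : 0 ≤ C * D * pq q 0 := by positivity
    have : 0 ≤ ‖cf a b c 1‖ / pq q 1 * pq q 0 := by positivity
    linarith
  | 1 =>
    have : ‖cf a b c 1‖ = ‖cf a b c 1‖ / pq q 1 * pq q 1 := by field_simp
    rw [add_mul, add_mul, ← this]
    have : 0 ≤ C * D * pq q 1 := by positivity
    have : 0 ≤ ‖cf a b c 0‖ / pq q 0 * pq q 1 := by positivity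
    linarith
  | n + 2 =>
    have h1 := hC' (n + 1) (by omega)
    have h2 := hD' (n + 1) (by omega)
    have h3 : ((n + 1 : ℕ) : ℝ) ^ (a + b - c).re ≤ ((n + 1 : ℕ) : ℝ) ^ q :=
      Real.rpow_le_rpow_of_exponent_le (by push_cast; linarith [n.cast_nonneg (α := ℝ)]) h
    have : ‖cf a b c (n + 2)‖ ≤ C * (D * pq q (n + 2)) := by
      refine h1.trans ?_
      gcongr
      refine le_trans ?_ h2
      gcongr
    have : 0 ≤ (‖cf a b c 0‖ / pq q 0 + ‖cf a b c 1‖ / pq q 1) * pq q (n + 2) := by positivity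
    linarith

lemma cf_summable (a b c : ℂ) {x : ℂ} (hx : ‖x‖ < 1) : Summable (fun k => ‖cf a b c k * x ^ k‖) := by
  obtain ⟨C, hC, h⟩ := cf_le_pq a b c (q := max 1 (a + b - c).re) (by positivity) (le_max_right _ _)
  refine Summable.of_nonneg_of_le (fun _ => norm_nonneg _) (fun k => ?_)
    ((pq_hasSum (max 1 (a + b - c).re) ‖x‖ (norm_nonneg _) hx).summable.mul_left C)
  rw [norm_mul, norm_pow, ← mul_assoc]
  gcongr
  exact h k

lemma hs_conv {ι : Type*} {f g : ι → ℂ} {x y : ℂ} (h : HasSum f x) (hfg : ∀ i, g i = f i)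
    (hxy : y = x) : HasSum g y := by
  have : g = f := funext hfg
  rw [this, hxy]; exact h


lemma beta_integrable {u v : ℂ} (hu : 0 < u.re) (hv : 0 < v.re) :
    IntegrableOn (fun s : ℝ => (s : ℂ) ^ (u - 1) * (1 - (s : ℂ)) ^ (v - 1)) (Ioo 0 1) := by
  have h := betaIntegral_convergent hu hv
  rw [intervalIntegrable_iff_integrableOn_Ioo_of_le zero_le_one] at h
  exact h

lemma beta_integral {u v : ℂ} (hu : 0 < u.re) (hv : 0 < v.re) :
    ∫ s in Ioo (0 : ℝ) 1, (s : ℂ) ^ (u - 1) * (1 - (s : ℂ)) ^ (v - 1) =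
      Gamma u * Gamma v / Gamma (u + v) := by
  rw [Gamma_mul_Gamma_eq_betaIntegral hu hv, betaIntegral,
    intervalIntegral.integral_of_le zero_le_one, integral_Ioc_eq_integral_Ioo]
  have : Gamma (u + v) ≠ 0 := Gamma_ne_zero_of_re_pos (by simp; linarith)
  field_simp

lemma norm_beta {s : ℝ} (hs : s ∈ Ioo (0 : ℝ) 1) (u v : ℂ) :
    ‖(s : ℂ) ^ (u - 1) * (1 - (s : ℂ)) ^ (v - 1)‖ = s ^ (u.re - 1) * (1 - s) ^ (v.re - 1) := by
  have h1 : (1 : ℂ) - s = ((1 - s : ℝ) : ℂ) := by push_cast; rfl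
  rw [norm_mul, h1, norm_cpow_eq_rpow_re_of_pos hs.1, norm_cpow_eq_rpow_re_of_pos (by linarith [hs.2])]
  simp

lemma beta_integrable_real {u v : ℝ} (hu : 0 < u) (hv : 0 < v) :
    IntegrableOn (fun s : ℝ => s ^ (u - 1) * (1 - s) ^ (v - 1)) (Ioo 0 1) := by
  have h := (beta_integrable (u := u) (v := v) (by simpa) (by simpa)).norm
  refine (integrableOn_congr_fun ?_ measurableSet_Ioo).mp h
  intro s hs
  simpa using norm_beta hs (u : ℂ) (v : ℂ)

lemma cf_one_one (a : ℂ) (k : ℕ) : cf a 1 1 k = poch a k / (k.factorial : ℂ) := by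
  have h2 : (k.factorial : ℂ) ≠ 0 := by exact_mod_cast k.factorial_ne_zero
  rw [cf, poch_one]; field_simp

lemma gauss_base {a b c : ℂ} (hb : 0 < b.re) (hcb : 0 < (c - b).re) (h : 0 < (c - a - b).re) :
    HasSum (cf a b c) (Gamma c * Gamma (c - a - b) / (Gamma (c - a) * Gamma (c - b))) := by
  simp only [sub_re] at hcb h
  have hc : 0 < c.re := by linarith
  obtain ⟨q, hq1, hq2⟩ : ∃ q, max 0 a.re < q ∧ q < c.re - b.re :=
    exists_between (max_lt (by linarith) (by linarith))
  have hq0 : 0 < q := (le_max_left _ _).trans_lt hq1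
  have hqa : a.re < q := (le_max_right _ _).trans_lt hq1
  obtain ⟨C, hC, hC'⟩ := cf_le_pq a 1 1 hq0 (by simpa using hqa.le)
  have key := hasSum_integral_of_dominated_convergence (μ := volume.restrict (Ioo (0:ℝ) 1))
    (F := fun (k : ℕ) (t : ℝ) => cf a 1 1 k * ((t : ℂ) ^ (b + k - 1) * (1 - (t : ℂ)) ^ (c - b - 1)))
    (f := fun t : ℝ => (t : ℂ) ^ (b - 1) * (1 - (t : ℂ)) ^ (c - a - b - 1))
    (fun k t => C * (pq q k * t ^ k) * (t ^ (b.re - 1) * (1 - t) ^ (c.re - b.re - 1)))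
    ?_ ?_ ?_ ?_ ?_
  · have key2 := key.mul_left (Gamma c / (Gamma b * Gamma (c - b)))
    rw [beta_integral hb (by simpa using h)] at key2
    have g1 : Gamma b ≠ 0 := Gamma_ne_zero_of_re_pos hb
    have g2 : Gamma (c - b) ≠ 0 := Gamma_ne_zero_of_re_pos (by simpa using hcb)
    have g3 : Gamma (c - a) ≠ 0 := Gamma_ne_zero_of_re_pos (by simp; linarith)
    have g4 : Gamma c ≠ 0 := Gamma_ne_zero_of_re_pos hc
    refine hs_conv key2 ?_ ?_
    · intro k
      have hbk : 0 < (b + k).re := by simp; positivity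
      rw [integral_const_mul, beta_integral hbk (by simpa using hcb), cf_one_one,
        show b + (k : ℂ) + (c - b) = c + k by ring, Gamma_add_nat (nonpole_of_re hb),
        Gamma_add_nat (nonpole_of_re hc), cf]
      have := poch_ne_zero (nonpole_of_re hc) k
      have h2 : (k.factorial : ℂ) ≠ 0 := by exact_mod_cast k.factorial_ne_zero
      field_simp
    · rw [show b + (c - a - b) = c - a by ring]
      field_simp
  · intro k
    have hbk : 0 < (b + k).re := by simp; positivity
    exact ((beta_integrable hbk (v := c - b) (by simpa using hcb)).const_mul _).aestronglyMeasurable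
  · intro k
    refine (ae_restrict_iff' measurableSet_Ioo).mpr (Eventually.of_forall fun t ht => ?_)
    rw [norm_mul, norm_beta ht, ← mul_assoc C]
    have : t ^ ((b + (k : ℂ)).re - 1) = t ^ k * t ^ (b.re - 1) := by
      rw [← Real.rpow_natCast t k, ← Real.rpow_add ht.1]
      congr 1; simp; ring
    rw [this, mul_assoc (t ^ k), ← mul_assoc, sub_re]
    have h1 := ht.1
    have h2 : 0 < 1 - t := by linarith [ht.2]
    gcongr
    exact hC' k
  · refine (ae_restrict_iff' measurableSet_Ioo).mpr (Eventually.of_forall fun t ht => ?_)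
    exact (((pq_hasSum q t ht.1.le ht.2).mul_left C).mul_right _).summable
  · have h1 : IntegrableOn (fun t : ℝ => C * (t ^ (b.re - 1) * (1 - t) ^ (c.re - b.re - q - 1))) (Ioo 0 1) :=
      (beta_integrable_real hb (by linarith)).const_mul C
    refine (integrableOn_congr_fun ?_ measurableSet_Ioo).mp h1
    intro t ht
    dsimp only
    rw [(((pq_hasSum q t ht.1.le ht.2).mul_left C).mul_right _).tsum_eq,
      show c.re - b.re - q - 1 = -q + (c.re - b.re - 1) by ring, Real.rpow_add (by linarith [ht.2])]
    ring
  · refine (ae_restrict_iff' measurableSet_Ioo).mpr (Eventually.of_forall fun t ht => ?_)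
    have ht0 : (t : ℂ) ≠ 0 := by exact_mod_cast ht.1.ne'
    have ht1 : (1 : ℂ) - t ≠ 0 := by
      rw [sub_ne_zero]; exact_mod_cast ht.2.ne'
    have := (binom_hasSum a t (by rw [norm_real, Real.norm_of_nonneg ht.1.le]; exact ht.2)).mul_right
      ((t : ℂ) ^ (b - 1) * (1 - (t : ℂ)) ^ (c - b - 1))
    refine hs_conv this ?_ ?_
    · intro k
      rw [cf_one_one, show b + (k : ℂ) - 1 = k + (b - 1) by ring, cpow_add _ _ ht0, cpow_natCast]
      ring
    · rw [show c - a - b - 1 = -a + (c - b - 1) by ring, cpow_add _ _ ht1]; ring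

lemma cf_decay {a b c : ℂ} (h : 0 < (c - a - b).re) :
    Summable (cf a b c) ∧ Tendsto (fun k : ℕ => (k : ℂ) * cf a b c k) atTop (𝓝 0) := by
  obtain ⟨C, hC, hC'⟩ := cf_bound a b c
  set δ := (c - a - b).re with hδ
  have hre : (a + b - c).re = -δ := by simp [hδ]; ring
  rw [hre] at hC'
  constructor
  · rw [← summable_nat_add_iff 2]
    have hs : Summable (fun n : ℕ => C * ((n + 1 : ℕ) : ℝ) ^ (-δ - 1)) :=
      ((summable_nat_add_iff 1).mpr (Real.summable_nat_rpow.mpr (by linarith))).mul_left C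
    refine Summable.of_norm_bounded hs (fun n => ?_)
    refine (hC' (n + 1) (by omega)).trans ?_
    have hp : (0:ℝ) < ((n + 1 : ℕ) : ℝ) := by positivity
    rw [Real.rpow_sub hp, Real.rpow_one]
    gcongr
    linarith
  · rw [← tendsto_add_atTop_iff_nat 1]
    have hz : Tendsto (fun n : ℕ => C * ((n : ℝ) ^ (-δ))) atTop (𝓝 0) := by
      simpa using ((tendsto_rpow_neg_atTop h).comp tendsto_natCast_atTop_atTop).const_mul C
    refine squeeze_zero_norm' ?_ hz
    filter_upwards [eventually_ne_atTop 0] with n hn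
    rw [norm_mul]
    have h6 : ‖((n + 1 : ℕ) : ℂ)‖ = n + 1 := by
      rw [norm_natCast]; push_cast; rfl
    rw [h6]
    have := hC' n hn
    calc ((n : ℝ) + 1) * ‖cf a b c (n + 1)‖ ≤ (n + 1) * (C * ((n : ℝ) ^ (-δ) / (n + 1))) := by gcongr
      _ = _ := by field_simp

lemma gauss_step {a b c : ℂ} (hc : ∀ n : ℕ, c ≠ -(n : ℂ)) (h : 0 < (c - a - b).re) :
    c * (c - a - b) * ∑' k, cf a b c k = (c - a) * (c - b) * ∑' k, cf a b (c + 1) k := by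
  have h1 := (cf_decay h).1
  have h2 := (cf_decay (a := a) (b := b) (c := c + 1) (by simp at h ⊢; linarith)).1
  have h3 := (cf_decay h).2
  have e : ∀ k : ℕ, c * (c - a - b) * cf a b c k - (c - a) * (c - b) * cf a b (c + 1) k =
      c * (k * cf a b c k) - c * (((k + 1 : ℕ) : ℂ) * cf a b c (k + 1)) := by
    intro k
    have hk : (k.factorial : ℂ) ≠ 0 := by exact_mod_cast k.factorial_ne_zero
    have hk1 : (k : ℂ) + 1 ≠ 0 := by exact_mod_cast k.succ_ne_zero
    have hp := poch_ne_zero hc k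
    have hck : c + k ≠ 0 := fun h => hc k (eq_neg_of_add_eq_zero_left h)
    have hc0 : c ≠ 0 := by simpa using hc 0
    have e1 : poch (c + 1) k = poch c k * (c + k) / c := by
      rw [← poch_succ, poch_succ']; field_simp
    rw [cf, cf, cf, e1, poch_succ, poch_succ, poch_succ, Nat.factorial_succ]
    push_cast
    field_simp
    ring
  have s1 : HasSum (fun k : ℕ => c * (c - a - b) * cf a b c k - (c - a) * (c - b) * cf a b (c + 1) k)
      (c * (c - a - b) * ∑' k, cf a b c k - (c - a) * (c - b) * ∑' k, cf a b (c + 1) k) :=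
    (h1.hasSum.mul_left _).sub (h2.hasSum.mul_left _)
  have t1 := s1.tendsto_sum_nat
  have t2 : Tendsto (fun n : ℕ => ∑ k ∈ Finset.range n,
      (c * (c - a - b) * cf a b c k - (c - a) * (c - b) * cf a b (c + 1) k)) atTop (𝓝 0) := by
    have : ∀ n : ℕ, ∑ k ∈ Finset.range n,
      (c * (c - a - b) * cf a b c k - (c - a) * (c - b) * cf a b (c + 1) k) = - (c * (n * cf a b c n)) := by
      intro n
      rw [Finset.sum_congr rfl (fun k _ => e k),
        Finset.sum_range_sub' (fun k : ℕ => c * ((k : ℂ) * cf a b c k))]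
      simp
    simp only [this]
    simpa using (h3.const_mul c).neg
  exact sub_eq_zero.mp (tendsto_nhds_unique t1 t2)

lemma gauss_aux {a b : ℂ} (hb : 0 < b.re) (N : ℕ) : ∀ c : ℂ, (∀ n : ℕ, c ≠ -(n : ℂ)) →
    (∀ n : ℕ, c - b ≠ -(n : ℂ)) → 0 < (c - a - b).re → 0 < (c - b).re + N →
    ∑' k, cf a b c k = Gamma c * Gamma (c - a - b) / (Gamma (c - a) * Gamma (c - b)) := by
  induction N with
  | zero =>
    intro c _ _ h h0
    exact (gauss_base hb (by simpa using h0) h).tsum_eq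
  | succ N ih =>
    intro c hc hcb h h0
    have hs := gauss_step hc h
    rw [ih (c + 1) (by simpa using nonpole_add hc 1)
      (by have := nonpole_add hcb 1; intro n; specialize this n; intro h; apply this; rw [← h]; push_cast; ring)
      (by simp at h ⊢; linarith) (by simp at h0 ⊢; linarith)] at hs
    have n1 : c ≠ 0 := by simpa using hc 0
    have n2 : c - b ≠ 0 := by simpa using hcb 0
    have n3 : c - a - b ≠ 0 := by intro h'; rw [h'] at h; simp at h
    have n4' : 0 < (c - a).re := by simp at h ⊢; linarith
    have n4 : c - a ≠ 0 := by intro h'; rw [h'] at n4'; simp at n4'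
    rw [show c + 1 - a - b = (c - a - b) + 1 by ring, show c + 1 - a = (c - a) + 1 by ring,
      show c + 1 - b = (c - b) + 1 by ring, Gamma_add_one _ n1, Gamma_add_one _ n2,
      Gamma_add_one _ n3, Gamma_add_one _ n4] at hs
    have g1 : Gamma (c - b) ≠ 0 := Gamma_ne_zero hcb
    have g2 : Gamma (c - a) ≠ 0 := Gamma_ne_zero_of_re_pos n4'
    apply mul_left_cancel₀ (mul_ne_zero n1 n3)
    rw [hs]
    field_simp

lemma gauss_sum {a b c : ℂ} (hb : 0 < b.re) (hc : ∀ n : ℕ, c ≠ -(n : ℂ))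
    (hcb : ∀ n : ℕ, c - b ≠ -(n : ℂ)) (h : 0 < (c - a - b).re) :
    HasSum (cf a b c) (Gamma c * Gamma (c - a - b) / (Gamma (c - a) * Gamma (c - b))) := by
  obtain ⟨N, hN⟩ := exists_nat_gt (-(c - b).re)
  rw [← gauss_aux hb N c hc hcb h (by linarith)]
  exact (cf_decay h).1.hasSum


lemma antidiag_sum (f : ℕ → ℂ) (p r : ℂ) (k : ℕ) :
    ∑ x ∈ Finset.HasAntidiagonal.antidiagonal k, f (x.1 + x.2) * ((x.1 + x.2).choose x.1 : ℂ) * p ^ x.1 * r ^ x.2 =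
      f k * (p + r) ^ k := by
  rw [(Commute.all p r).add_pow', Finset.mul_sum]
  refine Finset.sum_congr rfl fun x hx => ?_
  rw [Finset.HasAntidiagonal.mem_antidiagonal] at hx
  rw [hx, nsmul_eq_mul]; ring

lemma antidiag_sum_real (f : ℕ → ℝ) (p r : ℝ) (k : ℕ) :
    ∑ x ∈ Finset.HasAntidiagonal.antidiagonal k, f (x.1 + x.2) * ((x.1 + x.2).choose x.1 : ℝ) * p ^ x.1 * r ^ x.2 =
      f k * (p + r) ^ k := by
  rw [(Commute.all p r).add_pow', Finset.mul_sum]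
  refine Finset.sum_congr rfl fun x hx => ?_
  rw [Finset.HasAntidiagonal.mem_antidiagonal] at hx
  rw [hx, nsmul_eq_mul]; ring

/-- general rearrangement along antidiagonals -/
lemma antidiag_hasSum (g : ℕ × ℕ → ℂ) (h : Summable fun k => ∑ x ∈ Finset.HasAntidiagonal.antidiagonal k, ‖g x‖) :
    HasSum g (∑' k, ∑ x ∈ Finset.HasAntidiagonal.antidiagonal k, g x) := by
  have hs : Summable fun x : (Σ k : ℕ, Finset.HasAntidiagonal.antidiagonal k) => ‖g x.2‖ := by
    rw [summable_sigma_of_nonneg (fun _ => norm_nonneg _)]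
    refine ⟨fun k => (hasSum_fintype _).summable, ?_⟩
    refine h.congr fun k => ?_
    exact (Finset.tsum_subtype (Finset.HasAntidiagonal.antidiagonal k) (fun x => ‖g x‖)).symm
  rw [← Finset.HasAntidiagonal.sigmaAntidiagonalEquivProd.hasSum_iff]
  have h2 : Summable fun x : (Σ k : ℕ, Finset.HasAntidiagonal.antidiagonal k) => g x.2 := hs.of_norm
  have h3 := h2.hasSum
  rw [h2.tsum_sigma' (fun k => (hasSum_fintype _).summable)] at h3
  have : ∀ k, ∑' x : Finset.HasAntidiagonal.antidiagonal k, g x = ∑ x ∈ Finset.HasAntidiagonal.antidiagonal k, g x := fun k =>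
    Finset.tsum_subtype (Finset.HasAntidiagonal.antidiagonal k) g
  simp only [this] at h3
  exact h3

lemma pair_hasSum (f : ℕ → ℂ) (p r : ℂ) (h : Summable fun k => ‖f k‖ * (‖p‖ + ‖r‖) ^ k) :
    HasSum (fun x : ℕ × ℕ => f (x.1 + x.2) * ((x.1 + x.2).choose x.1 : ℂ) * p ^ x.1 * r ^ x.2)
      (∑' k, f k * (p + r) ^ k) := by
  have := antidiag_hasSum
    (fun x : ℕ × ℕ => f (x.1 + x.2) * ((x.1 + x.2).choose x.1 : ℂ) * p ^ x.1 * r ^ x.2) ?_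
  · simpa only [antidiag_sum] using this
  · refine h.congr fun k => ?_
    rw [← antidiag_sum_real (fun k => ‖f k‖)]
    refine Finset.sum_congr rfl fun x hx => ?_
    simp

lemma pair_pq (q p r : ℝ) (hq : 0 < q) (hp : 0 ≤ p) (hr : 0 ≤ r) (h : p + r < 1) :
    HasSum (fun x : ℕ × ℕ => pq q (x.1 + x.2) * ((x.1 + x.2).choose x.1 : ℝ) * p ^ x.1 * r ^ x.2)
      ((1 - (p + r)) ^ (-q)) := by
  have h1 := pq_hasSum q (p + r) (by positivity) h
  have h2 := pair_hasSum (fun k => (pq q k : ℂ)) p r ?_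
  · rw [← Complex.hasSum_ofReal]
    refine hs_conv h2 (fun x => by push_cast; rfl) ?_
    rw [← h1.tsum_eq, Complex.ofReal_tsum]
    push_cast; rfl
  · refine h1.summable.congr fun k => ?_
    simp only [norm_real, Real.norm_of_nonneg hp, Real.norm_of_nonneg hr,
      Real.norm_of_nonneg (pq_pos hq k).le]

lemma exists_q {a b c μ : ℂ} (hca : μ.re < (c - a).re) (hcb : μ.re < (c - b).re) :
    ∃ q : ℝ, 0 < q ∧ (a + (c - b) - c).re ≤ q ∧ q < (c - b).re - μ.re := by
  obtain ⟨q, h1, h2⟩ := exists_between (show max 0 (a + (c - b) - c).re < (c - b).re - μ.re from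
    max_lt (by linarith) (by simp at *; linarith))
  exact ⟨q, (le_max_left _ _).trans_lt h1, ((le_max_right _ _).trans_lt h1).le, h2⟩

lemma main_z {a b c μ : ℂ} (hca : μ.re < (c - a).re) (hcb : μ.re < (c - b).re)
    (hμ : 0 < μ.re)
    (hc1 : ∀ n : ℕ, c ≠ -(n : ℂ)) (hc2 : ∀ n : ℕ, c - μ ≠ -(n : ℂ))
    (z : ℝ) (hz0 : 0 ≤ z) (hz1 : z < 1) :
    ∫ s in Ioo (0:ℝ) 1, (∑' k, cf a (c - b) c k * ((z * (1 - s) + s : ℝ) : ℂ) ^ k) *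
        ((s : ℂ) ^ (μ - 1) * (1 - (s : ℂ)) ^ (c - b - μ - 1)) =
      Gamma μ * (Gamma (c - a - μ) / Gamma (c - a) *
        (Gamma (c - b - μ) / Gamma (c - b)) *
        (Gamma c / Gamma (c - μ))) * ∑' n, cf a (c - μ - b) (c - μ) n * (z : ℂ) ^ n := by
  obtain ⟨q, hq0, hq1, hq2⟩ := exists_q hca hcb
  obtain ⟨C, hC, hC'⟩ := cf_le_pq a (c - b) c hq0 hq1
  have hv : ∀ s ∈ Ioo (0:ℝ) 1, z * (1 - s) + s < 1 := by
    rintro s ⟨h0, h1⟩; nlinarith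
  have hAμ : 0 < (c - b - μ).re := by simp at *; linarith
  have key := hasSum_integral_of_dominated_convergence (μ := volume.restrict (Ioo (0:ℝ) 1))
    (F := fun (x : ℕ × ℕ) (s : ℝ) => (cf a (c - b) c (x.1 + x.2) * ((x.1 + x.2).choose x.1 : ℂ) *
      (z : ℂ) ^ x.1) * ((s : ℂ) ^ (μ + x.2 - 1) * (1 - (s : ℂ)) ^ (c - b - μ + x.1 - 1)))
    (f := fun s : ℝ => (∑' k, cf a (c - b) c k * ((z * (1 - s) + s : ℝ) : ℂ) ^ k) *
        ((s : ℂ) ^ (μ - 1) * (1 - (s : ℂ)) ^ (c - b - μ - 1)))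
    (fun x s => C * (pq q (x.1 + x.2) * ((x.1 + x.2).choose x.1 : ℝ) * (z * (1 - s)) ^ x.1 * s ^ x.2) *
       (s ^ (μ.re - 1) * (1 - s) ^ ((c - b - μ).re - 1)))
    ?_ ?_ ?_ ?_ ?_
  · have key2 := key.prod_fiberwise (g := fun n => Gamma μ * (Gamma (c - a - μ) / Gamma (c - a) *
        (Gamma (c - b - μ) / Gamma (c - b)) *
        (Gamma c / Gamma (c - μ))) * (cf a (c - μ - b) (c - μ) n * (z : ℂ) ^ n)) ?_
    · rw [← key2.tsum_eq, tsum_mul_left]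
    · intro n
      have hg := gauss_sum (a := a + n) (b := μ) (c := c + n) hμ (nonpole_add hc1 n)
        (by have := nonpole_add hc2 n; intro m; rw [show c + n - μ = c - μ + n by ring]; exact this m)
        (by simp at *; linarith)
      have hA : 0 < (c - b).re := by linarith
      have hca' : 0 < (c - a).re := by linarith
      refine hs_conv (hg.mul_left ((z : ℂ) ^ n * (Gamma (c - b - μ + n) / (Gamma (c - b) * (n.factorial : ℂ)))
        * (poch a n / poch c n) * Gamma μ)) ?_ ?_
      · intro m
        dsimp only
        rw [integral_const_mul, beta_integral (by simp; positivity) (by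
          rw [add_re, natCast_re]; positivity),
          show μ + (m : ℂ) + (c - b - μ + n) = (c - b) + ((n + m : ℕ) : ℂ) by push_cast; ring,
          Gamma_add_nat (nonpole_of_re hA), Gamma_add_nat (nonpole_of_re hμ), cf, cf,
          poch_add a n m, poch_add c n m, Nat.cast_choose ℂ (Nat.le_add_right n m),
          Nat.add_sub_cancel_left]
        have f1 : (n.factorial : ℂ) ≠ 0 := by exact_mod_cast n.factorial_ne_zero
        have f2 : (m.factorial : ℂ) ≠ 0 := by exact_mod_cast m.factorial_ne_zero
        have f3 : ((n + m).factorial : ℂ) ≠ 0 := by exact_mod_cast (n + m).factorial_ne_zero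
        have p1 := poch_ne_zero hc1 n
        have p2 := poch_ne_zero (nonpole_add hc1 n) m
        have p3 := poch_ne_zero (nonpole_of_re hA) (n + m)
        have g1 := Gamma_ne_zero_of_re_pos hA
        field_simp
      · rw [show c + (n : ℂ) - (a + n) - μ = c - a - μ by ring, show c + (n : ℂ) - (a + n) = c - a by ring,
          show c + (n : ℂ) - μ = (c - μ) + n by ring, Gamma_add_nat hc1, Gamma_add_nat hc2,
          Gamma_add_nat (nonpole_of_re hAμ), cf, show c - μ - b = c - b - μ by ring]
        have f1 : (n.factorial : ℂ) ≠ 0 := by exact_mod_cast n.factorial_ne_zero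
        have p1 := poch_ne_zero hc1 n
        have p2 := poch_ne_zero hc2 n
        have g1 := Gamma_ne_zero_of_re_pos hA
        have g2 := Gamma_ne_zero_of_re_pos hca'
        have g3 := Gamma_ne_zero hc2
        field_simp
  · intro x
    exact ((beta_integrable (u := μ + x.2) (v := c - b - μ + x.1) (by simp; positivity) (by
          rw [add_re, natCast_re]; positivity)).const_mul _).aestronglyMeasurable
  · intro x
    refine (ae_restrict_iff' measurableSet_Ioo).mpr (Eventually.of_forall fun t ht => ?_)
    have h1 := ht.1
    have h2 : 0 < 1 - t := by linarith [ht.2]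
    rw [norm_mul, norm_beta ht]
    have e1 : t ^ ((μ + (x.2 : ℂ)).re - 1) = t ^ x.2 * t ^ (μ.re - 1) := by
      rw [← Real.rpow_natCast t x.2, ← Real.rpow_add ht.1]
      congr 1; simp; ring
    have e2 : (1 - t) ^ ((c - b - μ + (x.1 : ℂ)).re - 1) =
        (1 - t) ^ x.1 * (1 - t) ^ ((c - b - μ).re - 1) := by
      rw [← Real.rpow_natCast (1 - t) x.1, ← Real.rpow_add h2]
      congr 1; simp; ring
    rw [e1, e2, norm_mul, norm_mul, norm_natCast, norm_pow, norm_real, Real.norm_of_nonneg hz0, mul_pow]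
    have := hC' (x.1 + x.2)
    calc _ = ‖cf a (c - b) c (x.1 + x.2)‖ * (((x.1 + x.2).choose x.1 : ℝ) *
        (z ^ x.1 * (1 - t) ^ x.1) * t ^ x.2 *
        (t ^ (μ.re - 1) * (1 - t) ^ ((c - b - μ).re - 1))) := by ring
      _ ≤ C * pq q (x.1 + x.2) * (((x.1 + x.2).choose x.1 : ℝ) *
        (z ^ x.1 * (1 - t) ^ x.1) * t ^ x.2 *
        (t ^ (μ.re - 1) * (1 - t) ^ ((c - b - μ).re - 1))) := by gcongr
      _ = _ := by ring
  · refine (ae_restrict_iff' measurableSet_Ioo).mpr (Eventually.of_forall fun t ht => ?_)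
    have h2 : 0 < 1 - t := by linarith [ht.2]
    exact (((pair_pq q (z * (1 - t)) t hq0 (by positivity) ht.1.le (hv t ht)).mul_left C).mul_right _).summable
  · have h1 : IntegrableOn (fun t : ℝ => C * (1 - z) ^ (-q) * (t ^ (μ.re - 1) *
        (1 - t) ^ ((c - b - μ).re - q - 1))) (Ioo 0 1) :=
      (beta_integrable_real hμ (by simp at *; linarith)).const_mul _
    refine (integrableOn_congr_fun ?_ measurableSet_Ioo).mp h1
    intro t ht
    have h2 : 0 < 1 - t := by linarith [ht.2]
    have h3 : 0 < 1 - z := by linarith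
    dsimp only
    rw [(((pair_pq q (z * (1 - t)) t hq0 (by positivity) ht.1.le (hv t ht)).mul_left C).mul_right _).tsum_eq,
      show (c - b - μ).re - q - 1 = -q + ((c - b - μ).re - 1) by ring, Real.rpow_add h2,
      show 1 - (z * (1 - t) + t) = (1 - z) * (1 - t) by ring, Real.mul_rpow h3.le h2.le]
    ring
  · refine (ae_restrict_iff' measurableSet_Ioo).mpr (Eventually.of_forall fun t ht => ?_)
    have ht0 : (t : ℂ) ≠ 0 := by exact_mod_cast ht.1.ne'
    have ht1 : (1 : ℂ) - t ≠ 0 := by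
      rw [sub_ne_zero]; exact_mod_cast ht.2.ne'
    have h2 : 0 < 1 - t := by linarith [ht.2]
    have hvt := hv t ht
    have hv0 : 0 ≤ z * (1 - t) + t := by have := ht.1; positivity
    have hp := pair_hasSum (cf a (c - b) c) ((z * (1 - t) : ℝ) : ℂ) (t : ℂ) ?_
    · refine hs_conv (hp.mul_right ((t : ℂ) ^ (μ - 1) * (1 - (t : ℂ)) ^ (c - b - μ - 1))) ?_ ?_
      · intro x
        rw [show μ + (x.2 : ℂ) - 1 = x.2 + (μ - 1) by ring, cpow_add _ _ ht0, cpow_natCast,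
          show c - b - μ + (x.1 : ℂ) - 1 = x.1 + (c - b - μ - 1) by ring, cpow_add _ _ ht1, cpow_natCast]
        push_cast
        rw [mul_pow]
        ring
      · push_cast; rfl
    · have := cf_summable a (c - b) c (x := ((z * (1 - t) + t : ℝ) : ℂ))
        (by rw [norm_real, Real.norm_of_nonneg hv0]; exact hvt)
      refine this.congr fun k => ?_
      rw [norm_mul, norm_pow, norm_real, norm_real, norm_real, Real.norm_of_nonneg hv0,
        Real.norm_of_nonneg ht.1.le, Real.norm_of_nonneg (by positivity)]


/-- power series -/
noncomputable def Pf (a b c : ℂ) (y : ℂ) : ℂ := ∑' k, cf a b c k * y ^ k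

/-- Pfaff series -/
noncomputable def Qf (a b c : ℂ) (y : ℂ) : ℂ := (1 - y) ^ (-a) * Pf a (c - b) c (y / (y - 1))

lemma vander (n : ℕ) : ∀ e c : ℂ, (∀ m : ℕ, c ≠ -(m : ℂ)) →
    ∑ x ∈ Finset.HasAntidiagonal.antidiagonal n,
      (n.choose x.1 : ℂ) * ((-1) ^ x.1 * (poch e x.1 / poch c x.1)) = poch (c - e) n / poch c n := by
  induction n with
  | zero => intro e c _; simp [poch_zero]
  | succ n ih =>
    intro e c hc
    rw [Finset.sum_antidiagonal_choose_succ_mul (fun i _ => (-1) ^ i * (poch e i / poch c i)), ih e c hc]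
    have hc' : ∀ m : ℕ, c + 1 ≠ -(m : ℂ) := by simpa using nonpole_add hc 1
    have hc0 : c ≠ 0 := by simpa using hc 0
    have h2 : ∑ x ∈ Finset.HasAntidiagonal.antidiagonal n,
        (n.choose x.2 : ℂ) * ((-1) ^ (x.1 + 1) * (poch e (x.1 + 1) / poch c (x.1 + 1))) =
        -(e / c) * (poch (c - e) n / poch (c + 1) n) := by
      have := ih (e + 1) (c + 1) hc'
      rw [show c + 1 - (e + 1) = c - e by ring] at this
      rw [← this, Finset.mul_sum]
      refine Finset.sum_congr rfl fun x hx => ?_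
      rw [Finset.HasAntidiagonal.mem_antidiagonal] at hx
      rw [← hx, Nat.choose_symm_add, poch_succ' e, poch_succ' c, pow_succ]
      have := poch_ne_zero hc' x.1
      field_simp
    rw [h2]
    have p1 := poch_ne_zero hc n
    have hck : c + n ≠ 0 := fun h => hc n (eq_neg_of_add_eq_zero_left h)
    have e1 : poch (c + 1) n = poch c n * (c + n) / c := by
      rw [← poch_succ, poch_succ']; field_simp
    rw [e1, poch_succ, poch_succ]
    field_simp
    ring

lemma poch_norm_le (s : ℂ) {q : ℝ} (h : ‖s‖ ≤ q) (k : ℕ) : ‖poch s k / (k.factorial : ℂ)‖ ≤ pq q k := by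
  rw [norm_div, norm_natCast, pq, poch, norm_prod]
  gcongr with i hi
  refine (norm_add_le _ _).trans ?_
  rw [norm_natCast]
  gcongr

lemma pfaff_B (a b c : ℂ) {r : ℝ} (hr0 : 0 ≤ r) (hr : r < 1 / 2) :
    Summable (fun x : ℕ × ℕ => ‖cf a (c - b) c x.1‖ * r ^ x.1 * (pq (‖a‖ + x.1) x.2 * r ^ x.2)) := by
  have hy1 : r < 1 := by linarith
  have hy2 : 0 < 1 - r := by linarith
  have hf : ∀ k : ℕ, HasSum (fun j : ℕ => ‖cf a (c - b) c k‖ * r ^ k * (pq (‖a‖ + k) j * r ^ j))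
      (‖cf a (c - b) c k‖ * r ^ k * (1 - r) ^ (-(‖a‖ + k))) := fun k =>
    (pq_hasSum (‖a‖ + k) r hr0 hy1).mul_left (‖cf a (c - b) c k‖ * r ^ k)
  refine (summable_prod_of_nonneg ?_).mpr ⟨fun k => (hf k).summable, ?_⟩
  · intro x
    have : 0 ≤ pq (‖a‖ + x.1) x.2 := (norm_nonneg _).trans
      (poch_norm_le (a + x.1) ((norm_add_le _ _).trans (by rw [norm_natCast])) x.2)
    simp only [Pi.zero_apply]
    positivity
  have h1 := cf_summable a (c - b) c (x := ((r / (1 - r) : ℝ) : ℂ)) (by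
    rw [norm_real, Real.norm_of_nonneg (by positivity), div_lt_one hy2]; linarith)
  refine (h1.mul_left ((1 - r) ^ (-‖a‖))).congr fun k => ?_
  refine Eq.trans ?_ (hf k).tsum_eq.symm
  rw [neg_add, Real.rpow_add hy2, Real.rpow_neg hy2.le (k : ℝ), Real.rpow_natCast, norm_mul,
    norm_pow, norm_real, Real.norm_of_nonneg (by positivity : 0 ≤ r / (1 - r)), div_pow]
  field_simp

set_option maxHeartbeats 1000000 in
lemma pfaff_small {a b c y : ℂ} (hc : ∀ n : ℕ, c ≠ -(n : ℂ)) (hy : ‖y‖ < 1 / 2) :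
    Pf a b c y = Qf a b c y := by
  set g : ℕ × ℕ → ℂ := fun x => cf a (c - b) c x.1 * (-1) ^ x.1 * y ^ x.1 *
    (poch (a + x.1) x.2 / (x.2.factorial : ℂ) * y ^ x.2) with hg
  have hy1 : ‖y‖ < 1 := by linarith
  have hy2 : 0 < 1 - ‖y‖ := by linarith
  have n1 : 1 - y ≠ 0 := by
    intro h
    rw [← sub_eq_zero.mp h] at hy1; simp at hy1
  have hs : Summable g := by
    have hBs := pfaff_B a b c (norm_nonneg y) hy
    refine Summable.of_norm_bounded hBs fun x => ?_
    simp only [hg, norm_mul, norm_pow, norm_neg, norm_one, one_pow, mul_one]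
    gcongr
    exact poch_norm_le (a + x.1) ((norm_add_le _ _).trans (by rw [norm_natCast])) x.2
  have h1 := hs.hasSum.prod_fiberwise (g := fun k => cf a (c - b) c k * (-1) ^ k * y ^ k *
    (1 - y) ^ (-(a + k))) (fun k => (binom_hasSum (a + k) y hy1).mul_left _)
  have h2 : Qf a b c y = ∑' x, g x := by
    rw [← h1.tsum_eq, Qf, Pf, ← tsum_mul_left]
    refine tsum_congr fun k => ?_
    rw [neg_add, cpow_add _ _ n1, cpow_neg _ (k : ℂ), cpow_natCast,
      show y / (y - 1) = (-1) * y / (1 - y) by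
        have : y - 1 ≠ 0 := by rw [← neg_sub]; exact neg_ne_zero.mpr n1
        field_simp; ring, div_pow, mul_pow]
    field_simp
  have h3 := Finset.HasAntidiagonal.sigmaAntidiagonalEquivProd.hasSum_iff.mpr hs.hasSum
  have h4 := h3.sigma (fun n => hasSum_fintype _)
  rw [h2, ← h4.tsum_eq, Pf]
  refine tsum_congr fun n => ?_
  have e : ∑ x : Finset.HasAntidiagonal.antidiagonal n, g x.1 =
      ∑ x ∈ Finset.HasAntidiagonal.antidiagonal n, g x := Finset.sum_coe_sort _ _
  refine Eq.trans ?_ e.symm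
  have v := vander n (c - b) c hc
  rw [show c - (c - b) = b by ring] at v
  have : cf a b c n * y ^ n = poch a n / (n.factorial : ℂ) * y ^ n * (poch b n / poch c n) := by
    rw [cf]
    have := poch_ne_zero hc n
    have f3 : (n.factorial : ℂ) ≠ 0 := by exact_mod_cast n.factorial_ne_zero
    field_simp
  rw [this, ← v, Finset.mul_sum]
  refine Finset.sum_congr rfl fun x hx => ?_
  rw [Finset.HasAntidiagonal.mem_antidiagonal] at hx
  obtain ⟨k, j⟩ := x
  simp only at hx
  subst hx
  simp only [hg, cf]
  rw [Nat.cast_choose ℂ (Nat.le_add_right k j), Nat.add_sub_cancel_left, poch_add a, pow_add]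
  have f1 : (k.factorial : ℂ) ≠ 0 := by exact_mod_cast k.factorial_ne_zero
  have f2 : (j.factorial : ℂ) ≠ 0 := by exact_mod_cast j.factorial_ne_zero
  have f3 : ((k + j).factorial : ℂ) ≠ 0 := by exact_mod_cast (k + j).factorial_ne_zero
  have p1 := poch_ne_zero hc k
  field_simp

lemma Pf_diff (a b c : ℂ) : DifferentiableOn ℂ (Pf a b c) (Metric.ball 0 1) := by
  intro y hy
  rw [mem_ball_zero_iff] at hy
  obtain ⟨r, hr1, hr2⟩ := exists_between hy
  have hr0 : 0 ≤ r := (norm_nonneg y).trans hr1.le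
  have hs := cf_summable a b c (x := (r : ℂ)) (by rw [norm_real, Real.norm_of_nonneg hr0]; exact hr2)
  have h := differentiableOn_tsum_of_summable_norm (F := fun k (y : ℂ) => cf a b c k * y ^ k)
    (U := Metric.ball 0 r) hs (fun k => by fun_prop) Metric.isOpen_ball (fun k w hw => by
      rw [mem_ball_zero_iff] at hw
      rw [norm_mul, norm_mul, norm_pow, norm_pow, norm_real, Real.norm_of_nonneg hr0]
      gcongr)
  exact (h.differentiableAt (Metric.isOpen_ball.mem_nhds (by rw [mem_ball_zero_iff]; exact hr1))).differentiableWithinAt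

lemma z_norm {y : ℂ} (hy : y.re < 1 / 2) : ‖y / (y - 1)‖ < 1 := by
  have h1 : ‖y‖ < ‖y - 1‖ := by
    rw [← sq_lt_sq₀ (norm_nonneg _) (norm_nonneg _), ← normSq_eq_norm_sq, ← normSq_eq_norm_sq,
      normSq_apply, normSq_apply]
    simp
    nlinarith
  rw [norm_div, div_lt_one ((norm_nonneg _).trans_lt h1)]
  exact h1

lemma one_sub_slit {y : ℂ} (hy : y.re < 1) : 1 - y ∈ slitPlane := by
  left; simp; exact hy

lemma isOpen_half : IsOpen {y : ℂ | y.re < 1 / 2} := isOpen_lt continuous_re continuous_const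

lemma Qf_diff (a b c : ℂ) : DifferentiableOn ℂ (Qf a b c) {y | y.re < 1 / 2} := by
  intro y hy
  have hy' : y.re < 1 / 2 := hy
  have h1 : 1 - y ∈ slitPlane := one_sub_slit (by linarith)
  have h2 : y - 1 ≠ 0 := by
    intro h; rw [sub_eq_zero.mp h] at hy'; norm_num at hy'
  have h3 := (Pf_diff a (c - b) c).differentiableAt
    (Metric.isOpen_ball.mem_nhds (by rw [mem_ball_zero_iff]; exact z_norm hy'))
  have h4 : DifferentiableAt ℂ (fun y : ℂ => y / (y - 1)) y := by fun_prop (disch := assumption)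
  have h5 : DifferentiableAt ℂ (fun y : ℂ => (1 - y) ^ (-a)) y := by
    fun_prop (disch := assumption)
  exact (h5.mul (h3.comp y h4)).differentiableWithinAt

lemma pfaff {a b c y : ℂ} (hc : ∀ n : ℕ, c ≠ -(n : ℂ)) (hy : ‖y‖ < 1) (hy2 : y.re < 1 / 2) :
    Pf a b c y = Qf a b c y := by
  set V : Set ℂ := Metric.ball 0 1 ∩ {y | y.re < 1 / 2} with hV
  have hVo : IsOpen V := Metric.isOpen_ball.inter isOpen_half
  have hVc : IsPreconnected V :=
    ((convex_ball _ _).inter (convex_halfSpace_re_lt _)).isPreconnected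
  have h1 : AnalyticOnNhd ℂ (Pf a b c) V :=
    ((Pf_diff a b c).mono inter_subset_left).analyticOnNhd hVo
  have h2 : AnalyticOnNhd ℂ (Qf a b c) V :=
    ((Qf_diff a b c).mono inter_subset_right).analyticOnNhd hVo
  refine h1.eqOn_of_preconnected_of_eventuallyEq h2 hVc (z₀ := 0) (by simp [hV]) ?_
    (show y ∈ V from ⟨by simpa using hy, hy2⟩)
  filter_upwards [Metric.ball_mem_nhds (0 : ℂ) (by norm_num : (0:ℝ) < 1 / 2)] with w hw
  exact pfaff_small hc (by simpa using hw)

/-- the domain -/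
def UU : Set ℂ := Metric.ball 0 1 ∪ {y | y.re < 1 / 2}

open Classical in
/-- continuation -/
noncomputable def Ff (a b c y : ℂ) : ℂ := if ‖y‖ < 1 then Pf a b c y else Qf a b c y

lemma UU_open : IsOpen UU := Metric.isOpen_ball.union isOpen_half

lemma UU_preconn : IsPreconnected UU := by
  refine IsPreconnected.union 0 (by simp) (by simp) (convex_ball _ _).isPreconnected
    (convex_halfSpace_re_lt _).isPreconnected

lemma UU_re {y : ℂ} (hy : y ∈ UU) : y.re < 1 := by
  rcases hy with h | h
  · rw [mem_ball_zero_iff] at h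
    exact (re_le_norm y).trans_lt h
  · have : y.re < 1 / 2 := h
    linarith

lemma UU_sub {y : ℂ} (hy : y ∈ UU) {t : ℝ} (ht : 0 ≤ t) : y - t ∈ UU := by
  by_cases h : (y - t).re < 1 / 2
  · exact Or.inr h
  · left
    rcases hy with h1 | h1
    · rw [mem_ball_zero_iff] at h1 ⊢
      refine lt_of_le_of_lt ?_ h1
      rw [← sq_le_sq₀ (norm_nonneg _) (norm_nonneg _), ← normSq_eq_norm_sq, ← normSq_eq_norm_sq,
        normSq_apply, normSq_apply]
      simp at h ⊢
      nlinarith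
    · have : y.re < 1 / 2 := h1
      simp at h
      linarith

lemma UU_real {x : ℝ} (hx : x < 1) : (x : ℂ) ∈ UU := by
  by_cases h : x < 1 / 2
  · right; simpa using h
  · left
    push Not at h
    rw [mem_ball_zero_iff, norm_real, Real.norm_of_nonneg (by linarith)]
    exact hx

lemma Ff_Q {a b c y : ℂ} (hc : ∀ n : ℕ, c ≠ -(n : ℂ)) (hy2 : y.re < 1 / 2) :
    Ff a b c y = Qf a b c y := by
  unfold Ff
  split_ifs with h
  · exact pfaff hc h hy2
  · rfl

lemma Ff_diff {a b c : ℂ} (hc : ∀ n : ℕ, c ≠ -(n : ℂ)) : DifferentiableOn ℂ (Ff a b c) UU := by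
  intro y hy
  refine DifferentiableAt.differentiableWithinAt ?_
  rcases hy with h | h
  · have hn := Metric.isOpen_ball.mem_nhds h
    refine ((Pf_diff a b c).differentiableAt hn).congr_of_eventuallyEq ?_
    filter_upwards [hn] with w hw
    rw [mem_ball_zero_iff] at hw
    simp [Ff, hw]
  · have hn := isOpen_half.mem_nhds h
    refine ((Qf_diff a b c).differentiableAt hn).congr_of_eventuallyEq ?_
    filter_upwards [hn] with w hw
    exact Ff_Q hc hw

lemma hypF_eq {a b c : ℂ} (hc : ∀ n : ℕ, c ≠ -(n : ℂ)) {x : ℝ} (hx : x < 1) :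
    hypF a b c x = Ff a b c x := by
  unfold hypF
  split_ifs with h
  · have : ‖(x : ℂ)‖ < 1 := by rw [norm_real, Real.norm_of_nonneg h]; exact hx
    simp only [Ff, this, if_true]
    rfl
  · push Not at h
    rw [Ff_Q hc (by simp; linarith)]
    simp only [Qf, Pf, cf]
    push_cast
    rfl


lemma cpow_exp {r : ℝ} (hr : 0 < r) (s : ℂ) : (r : ℂ) ^ s = Complex.exp ((Real.log r : ℝ) * s) := by
  rw [cpow_def_of_ne_zero (by exact_mod_cast hr.ne'), ofReal_log hr.le]

lemma pow_aux {u v s : ℝ} (hu : 0 < u) (hv : 0 < v) (hs : 0 < s) (a b c μ : ℂ) :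
    ((u / v ^ 2 : ℝ) : ℂ) * (((u / v : ℝ) : ℂ) ^ (a + b - c) * ((u / v : ℝ) : ℂ) ^ (-a) *
      ((u * s / v : ℝ) : ℂ) ^ (μ - 1)) =
    (u : ℂ) ^ (b - c + μ) * ((s : ℂ) ^ (μ - 1) * (v : ℂ) ^ (c - b - μ - 1)) := by
  have h1 : ((u / v ^ 2 : ℝ) : ℂ) = ((u / v ^ 2 : ℝ) : ℂ) ^ (1 : ℂ) := (cpow_one _).symm
  rw [h1, cpow_exp (by positivity), cpow_exp (by positivity), cpow_exp (by positivity),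
    cpow_exp (by positivity), cpow_exp (by positivity), cpow_exp (by positivity),
    cpow_exp (by positivity), Real.log_div (by positivity) (by positivity),
    Real.log_div (by positivity) (by positivity), Real.log_div (by positivity) (by positivity),
    Real.log_mul (by positivity) (by positivity), Real.log_pow]
  simp only [← Complex.exp_add]
  congr 1
  push_cast
  ring

lemma img (x : ℝ) (hx : x < 1) : (fun s : ℝ => 1 - (1 - x) / (1 - s)) '' Ioo 0 1 = Iio x := by
  have hu : 0 < 1 - x := by linarith
  ext y
  simp only [mem_image, mem_Ioo, mem_Iio]
  constructor
  · rintro ⟨s, ⟨h0, h1⟩, rfl⟩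
    have hv : 0 < 1 - s := by linarith
    have : 1 - x < (1 - x) / (1 - s) := by
      rw [lt_div_iff₀ hv]; nlinarith
    linarith
  · intro h
    have hy : 0 < 1 - y := by linarith
    refine ⟨1 - (1 - x) / (1 - y), ⟨?_, ?_⟩, ?_⟩
    · rw [sub_pos, div_lt_one hy]; linarith
    · have : 0 < (1 - x) / (1 - y) := by positivity
      linarith
    · rw [sub_sub_cancel, div_div_cancel₀ hu.ne']
      ring

lemma main_x {a b c μ : ℂ} (hca : μ.re < (c - a).re) (hcb : μ.re < (c - b).re)
    (hμ : 0 < μ.re)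
    (hc1 : ∀ n : ℕ, c ≠ -(n : ℂ)) (hc2 : ∀ n : ℕ, c - μ ≠ -(n : ℂ))
    (x : ℝ) (hx : x < 0) :
    ∫ y in Iio x, ((1 - y : ℝ) : ℂ) ^ (a + b - c) * hypF a b c y * ((x - y : ℝ) : ℂ) ^ (μ - 1)
      = Complex.Gamma μ * (Complex.Gamma (c - a - μ) / Complex.Gamma (c - a) *
        (Complex.Gamma (c - b - μ) / Complex.Gamma (c - b)) *
        (Complex.Gamma c / Complex.Gamma (c - μ))) *
        (((1 - x : ℝ) : ℂ) ^ (a + b - c + μ) * hypF a b (c - μ) x) := by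
  have hu : 0 < 1 - x := by linarith
  have hx1 : x - 1 ≠ 0 := by linarith
  rw [← img x (by linarith), integral_image_eq_integral_abs_deriv_smul (f' := fun s => -((1 - x) / (1 - s) ^ 2))
    measurableSet_Ioo]
  · have hz0 : 0 ≤ x / (x - 1) := div_nonneg_of_nonpos hx.le (by linarith)
    have hz1 : x / (x - 1) < 1 := by rw [div_lt_one_of_neg (by linarith)]; linarith
    have hm := main_z hca hcb hμ hc1 hc2 (x / (x - 1)) hz0 hz1
    have hR : ((1 - x : ℝ) : ℂ) ^ (a + b - c + μ) * hypF a b (c - μ) x =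
        ((1 - x : ℝ) : ℂ) ^ (b - c + μ) *
          ∑' n, cf a (c - μ - b) (c - μ) n * ((x / (x - 1) : ℝ) : ℂ) ^ n := by
      rw [hypF, if_neg (by linarith), ← mul_assoc, ← cpow_add _ _ (by exact_mod_cast hu.ne')]
      congr 2
      ring
    rw [hR, mul_left_comm, ← hm, ← integral_const_mul]
    refine setIntegral_congr_fun measurableSet_Ioo fun s hs => ?_
    obtain ⟨h0, h1⟩ := hs
    have hv : 0 < 1 - s := by linarith
    have hlt : 1 - (1 - x) / (1 - s) < 0 := by
      rw [sub_neg, lt_div_iff₀ hv]; nlinarith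
    have e1 : 1 - (1 - (1 - x) / (1 - s)) = (1 - x) / (1 - s) := by ring
    have e2 : x - (1 - (1 - x) / (1 - s)) = (1 - x) * s / (1 - s) := by field_simp; ring
    have e3 : (1 - (1 - x) / (1 - s)) / (1 - (1 - x) / (1 - s) - 1) = x / (x - 1) * (1 - s) + s := by
      rw [show 1 - (1 - x) / (1 - s) - 1 = - ((1 - x) / (1 - s)) by ring]
      rw [show x - 1 = -(1 - x) by ring]
      field_simp
      ring
    have e4 : |-((1 - x) / (1 - s) ^ 2)| = (1 - x) / (1 - s) ^ 2 := by
      rw [abs_neg, abs_of_pos (by positivity)]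
    have hp := pow_aux hu hv h0 a b c μ
    simp only [e4, e1, e2]
    rw [hypF, if_neg (by linarith), e1, e3, real_smul]
    simp only [cf]
    have : (1 - (s : ℂ)) = ((1 - s : ℝ) : ℂ) := by push_cast; rfl
    rw [this]
    linear_combination (∑' k : ℕ, poch a k * poch (c - b) k / (poch c k * (Nat.factorial k : ℂ)) *
        (((x / (x - 1) * (1 - s) + s : ℝ)) : ℂ) ^ k) * hp
  · intro s hs
    have hv : 1 - s ≠ 0 := by have := hs.2; linarith
    have h := ((hasDerivAt_const s (1 - x)).div ((hasDerivAt_id s).const_sub 1) hv).const_sub 1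
    refine (h.congr_deriv ?_).hasDerivWithinAt
    simp
  · intro s hs t ht h
    have hv : 1 - s ≠ 0 := by have := hs.2; linarith
    have hw : 1 - t ≠ 0 := by have := ht.2; linarith
    simp only [sub_right_inj] at h
    field_simp at h
    linarith


/-- the analytic factor of the integrand -/
noncomputable def GG (a b c y : ℂ) : ℂ := (1 - y) ^ (a + b - c) * Ff a b c y

lemma pre_diff (s : ℂ) : DifferentiableOn ℂ (fun y : ℂ => (1 - y) ^ s) UU := by
  intro y hy
  have h1 : 1 - y ∈ slitPlane := one_sub_slit (UU_re hy)
  have h5 : DifferentiableAt ℂ (fun y : ℂ => (1 - y) ^ s) y := by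
    fun_prop (disch := assumption)
  exact h5.differentiableWithinAt

lemma GG_diff {a b c : ℂ} (hc : ∀ n : ℕ, c ≠ -(n : ℂ)) : DifferentiableOn ℂ (GG a b c) UU :=
  (pre_diff _).mul (Ff_diff hc)

lemma Pf_bound {a b c : ℂ} {q C : ℝ} (hC : ∀ k, ‖cf a b c k‖ ≤ C * pq q k) {z : ℂ} (hz : ‖z‖ < 1) :
    ‖Pf a b c z‖ ≤ C * (1 - ‖z‖) ^ (-q) := by
  refine tsum_of_norm_bounded ((pq_hasSum q ‖z‖ (norm_nonneg _) hz).mul_left C) fun k => ?_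
  rw [norm_mul, norm_pow, ← mul_assoc]
  gcongr
  exact hC k

lemma cpow_bd (w s : ℂ) : ‖w ^ s‖ ≤ Real.exp (Real.pi * |s.im|) * ‖w‖ ^ s.re := by
  refine (norm_cpow_le w s).trans ?_
  rw [div_eq_mul_inv, ← Real.exp_neg, mul_comm]
  gcongr
  refine (le_abs_self _).trans ?_
  rw [abs_neg, abs_mul]
  gcongr
  exact abs_arg_le_pi w

lemma z_far {y : ℂ} {M : ℝ} (hM : 0 ≤ M) (hy : y.re ≤ -1) (hi : |y.im| ≤ M) :
    (2 * (1 + M) * ‖1 - y‖)⁻¹ ≤ 1 - ‖y / (y - 1)‖ := by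
  have hre : (1 - y).re = 1 - y.re := by simp
  have hw1 : 1 - y.re ≤ ‖1 - y‖ := by rw [← hre]; exact re_le_norm _
  have hw2 : ‖1 - y‖ ≤ (1 - y.re) + M := by
    refine (norm_le_abs_re_add_abs_im _).trans ?_
    rw [hre, abs_of_pos (by linarith)]
    simpa using hi
  have hw0 : 0 < ‖1 - y‖ := by linarith
  have hsq : ‖1 - y‖ ^ 2 - ‖y‖ ^ 2 = 1 - 2 * y.re := by
    rw [← normSq_eq_norm_sq, ← normSq_eq_norm_sq, normSq_apply, normSq_apply]
    simp
    ring
  have hle : ‖y‖ ≤ ‖1 - y‖ := by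
    rw [← sq_le_sq₀ (norm_nonneg _) (norm_nonneg _)]; linarith
  rw [norm_div, norm_sub_rev y 1, one_sub_div hw0.ne', inv_eq_one_div, div_le_div_iff₀ (by positivity) hw0]
  have h1 : ‖1 - y‖ ≤ (1 + M) * (1 - 2 * y.re) := by nlinarith
  have h2 : 1 - 2 * y.re ≤ (‖1 - y‖ - ‖y‖) * (2 * ‖1 - y‖) := by
    rw [← hsq]
    nlinarith
  nlinarith

lemma GG_decay {a b c : ℂ} (hc : ∀ n : ℕ, c ≠ -(n : ℂ)) {q : ℝ} (hq0 : 0 < q)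
    (hq1 : (a + (c - b) - c).re ≤ q) {M : ℝ} (hM : 0 ≤ M) :
    ∃ C, 0 ≤ C ∧ ∀ y : ℂ, y.re ≤ -1 → |y.im| ≤ M → ‖GG a b c y‖ ≤ C * ‖1 - y‖ ^ (-((c - b).re - q)) := by
  obtain ⟨C, hC, hC'⟩ := cf_le_pq a (c - b) c hq0 hq1
  refine ⟨Real.exp (Real.pi * |(b - c).im|) * (C * (2 * (1 + M)) ^ q), by positivity, fun y hy hi => ?_⟩
  have hw0 : 0 < ‖1 - y‖ := by
    have hre : (1 - y).re = 1 - y.re := by simp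
    have hw1 : 1 - y.re ≤ ‖1 - y‖ := by rw [← hre]; exact re_le_norm _
    linarith
  have hG : GG a b c y = (1 - y) ^ (b - c) * Pf a (c - b) c (y / (y - 1)) := by
    rw [GG, Ff_Q hc (by linarith), Qf, ← mul_assoc, ← cpow_add _ _ (norm_pos_iff.mp hw0)]
    congr 2
    ring
  have h1 := Pf_bound hC' (z_norm (show y.re < 1 / 2 by linarith))
  have h2 := z_far hM hy hi
  have h3 : (1 - ‖y / (y - 1)‖) ^ (-q) ≤ (2 * (1 + M)) ^ q * ‖1 - y‖ ^ q := by
    have h4 := Real.rpow_le_rpow_of_nonpos (by positivity) h2 (by linarith : -q ≤ 0)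
    rw [← Real.mul_rpow (by positivity) hw0.le]
    rwa [Real.inv_rpow (by positivity), Real.rpow_neg (by positivity : 0 ≤ 2 * (1 + M) * ‖1 - y‖), inv_inv] at h4
  rw [hG, norm_mul]
  calc _ ≤ (Real.exp (Real.pi * |(b - c).im|) * ‖1 - y‖ ^ (b - c).re) *
        (C * ((2 * (1 + M)) ^ q * ‖1 - y‖ ^ q)) := by
        gcongr
        · exact cpow_bd _ _
        · exact h1.trans (by gcongr)
    _ = _ := by
        rw [show -((c - b).re - q) = (b - c).re + q by simp; ring, Real.rpow_add hw0]
        ring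

lemma bd_exists {a b c μ : ℂ} (hca : μ.re < (c - a).re) (hcb : μ.re < (c - b).re)
    (hμ : 0 < μ.re) (hc : ∀ n : ℕ, c ≠ -(n : ℂ)) {x0 : ℂ} (hx0 : x0 ∈ UU) :
    ∃ r > 0, Metric.closedBall x0 r ⊆ UU ∧ ∃ β : ℝ → ℝ, IntegrableOn β (Ioi 0) ∧
      ∀ x ∈ Metric.closedBall x0 r, ∀ t : ℝ, 0 < t → ‖GG a b c (x - t) * (t : ℂ) ^ (μ - 1)‖ ≤ β t := by
  obtain ⟨r, hr, hrU⟩ := Metric.nhds_basis_closedBall.mem_iff.mp (UU_open.mem_nhds hx0)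
  refine ⟨r, hr, hrU, ?_⟩
  obtain ⟨q, hq0, hq1, hq2⟩ := exists_q hca hcb
  obtain ⟨C2, hC20, hC2⟩ := GG_decay hc hq0 hq1 (M := |x0.im| + r) (by positivity)
  have hK : IsCompact (Metric.closedBall x0 r ×ˢ Icc (0:ℝ) 2) :=
    (isCompact_closedBall _ _).prod isCompact_Icc
  have hcont : ContinuousOn (fun p : ℂ × ℝ => GG a b c (p.1 - p.2)) (Metric.closedBall x0 r ×ˢ Icc (0:ℝ) 2) := by
    refine (GG_diff hc).continuousOn.comp (by fun_prop) ?_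
    rintro ⟨x, t⟩ ⟨h1, h2⟩
    exact UU_sub (hrU h1) h2.1
  obtain ⟨C1, hC1⟩ := hK.exists_bound_of_continuousOn hcont
  refine ⟨fun t => if t ≤ 2 then C1 * t ^ (μ.re - 1) else C2 * t ^ (-((c - b).re - q) + (μ.re - 1)), ?_, ?_⟩
  · rw [← Ioc_union_Ioi_eq_Ioi (zero_le_two : (0:ℝ) ≤ 2)]
    refine IntegrableOn.union ?_ ?_
    · have : IntegrableOn (fun t : ℝ => C1 * t ^ (μ.re - 1)) (Ioc 0 2) :=
        ((intervalIntegrable_iff_integrableOn_Ioc_of_le zero_le_two).mp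
          (intervalIntegral.intervalIntegrable_rpow' (by linarith))).const_mul C1
      refine this.congr_fun (fun t ht => ?_) measurableSet_Ioc
      simp [ht.2]
    · have : IntegrableOn (fun t : ℝ => C2 * t ^ (-((c - b).re - q) + (μ.re - 1))) (Ioi 2) :=
        (integrableOn_Ioi_rpow_of_lt (by linarith) two_pos).const_mul C2
      refine this.congr_fun (fun t ht => ?_) measurableSet_Ioi
      have : ¬ t ≤ 2 := not_le.mpr ht
      simp [this]
  · intro x hx t ht
    rw [norm_mul, norm_cpow_eq_rpow_re_of_pos ht, sub_re, one_re]
    have hxU := hrU hx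
    have hre := UU_re hxU
    beta_reduce
    split_ifs with h
    · gcongr
      exact hC1 (x, t) ⟨hx, ht.le, h⟩
    · push Not at h
      rw [Real.rpow_add ht, ← mul_assoc]
      gcongr
      refine (hC2 _ (by simp; linarith) ?_).trans ?_
      · rw [mem_closedBall_iff_norm] at hx
        have h1 : |(x - x0).im| ≤ r := (abs_im_le_norm _).trans hx
        have : (x - t).im = x0.im + (x - x0).im := by simp
        rw [this]
        exact (abs_add_le _ _).trans (by gcongr)
      · refine mul_le_mul_of_nonneg_left (Real.rpow_le_rpow_of_nonpos ht ?_ (by linarith)) hC20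
        refine le_trans ?_ (re_le_norm _)
        simp
        linarith

/-- the parametrised integral -/
noncomputable def II (a b c μ x : ℂ) : ℂ := ∫ t in Ioi (0:ℝ), GG a b c (x - t) * (t : ℂ) ^ (μ - 1)

lemma meas_aux {g : ℂ → ℂ} (hg : ContinuousOn g UU) {x : ℂ} (hx : x ∈ UU) (μ : ℂ) :
    AEStronglyMeasurable (fun t : ℝ => g (x - t) * (t : ℂ) ^ (μ - 1)) (volume.restrict (Ioi 0)) := by
  refine ContinuousOn.aestronglyMeasurable ?_ measurableSet_Ioi
  refine ContinuousOn.mul (hg.comp (by fun_prop) fun t ht => UU_sub hx (le_of_lt ht)) ?_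
  intro t ht
  exact (continuousAt_ofReal_cpow_const t (μ - 1) (Or.inr (ne_of_gt ht))).continuousWithinAt

lemma II_diff {a b c μ : ℂ} (hca : μ.re < (c - a).re) (hcb : μ.re < (c - b).re)
    (hμ : 0 < μ.re) (hc : ∀ n : ℕ, c ≠ -(n : ℂ)) : DifferentiableOn ℂ (II a b c μ) UU := by
  intro x0 hx0
  obtain ⟨r, hr, hrU, β, hβ, hb⟩ := bd_exists hca hcb hμ hc hx0
  have hGd := GG_diff (a := a) (b := b) hc
  have hr2 : 0 < r / 2 := by linarith
  have hd : ∀ x ∈ UU, ∀ t : ℝ, 0 < t → HasDerivAt (fun x : ℂ => GG a b c (x - t) * (t : ℂ) ^ (μ - 1))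
      (deriv (GG a b c) (x - t) * (t : ℂ) ^ (μ - 1)) x := by
    intro x hx t ht
    have h1 := (hGd.differentiableAt (UU_open.mem_nhds (UU_sub hx ht.le))).hasDerivAt
    exact (h1.comp_sub_const x (t : ℂ)).mul_const _
  have hsub : Metric.ball x0 (r / 2) ⊆ UU := fun x hx =>
    hrU (Metric.closedBall_subset_closedBall (by linarith) (Metric.ball_subset_closedBall hx))
  have key := hasDerivAt_integral_of_dominated_loc_of_deriv_le (μ := volume.restrict (Ioi (0:ℝ)))
    (F := fun (x : ℂ) (t : ℝ) => GG a b c (x - t) * (t : ℂ) ^ (μ - 1))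
    (F' := fun (x : ℂ) (t : ℝ) => deriv (GG a b c) (x - t) * (t : ℂ) ^ (μ - 1))
    (x₀ := x0) (s := Metric.ball x0 (r / 2)) (bound := fun t => β t / (r / 2))
    (Metric.ball_mem_nhds _ hr2) ?_ ?_ ?_ ?_ ?_ ?_
  · exact key.2.differentiableAt.differentiableWithinAt
  · filter_upwards [UU_open.mem_nhds hx0] with x hx
    exact meas_aux hGd.continuousOn hx μ
  · refine Integrable.mono' hβ (meas_aux hGd.continuousOn hx0 μ) ?_
    filter_upwards [ae_restrict_mem measurableSet_Ioi] with t ht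
    exact hb x0 (Metric.mem_closedBall_self hr.le) t ht
  · exact meas_aux (hGd.deriv UU_open).continuousOn hx0 μ
  · filter_upwards [ae_restrict_mem measurableSet_Ioi] with t ht x hx
    rw [← (hd x (hsub hx) t ht).deriv]
    have hcb' : Metric.closedBall x (r / 2) ⊆ Metric.closedBall x0 r := by
      refine Metric.closedBall_subset_closedBall' ?_
      rw [Metric.mem_ball] at hx
      linarith
    refine norm_deriv_le_of_forall_mem_sphere_norm_le hr2 ?_ fun w hw =>
      hb w (hcb' (Metric.sphere_subset_closedBall hw)) t ht
    refine DifferentiableOn.diffContOnCl_ball (U := UU) (fun w hw => ?_) (hcb'.trans hrU)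
    exact (hd w hw t ht).differentiableAt.differentiableWithinAt
  · exact hβ.div_const _
  · filter_upwards [ae_restrict_mem measurableSet_Ioi] with t ht x hx
    exact hd x (hsub hx) t ht

lemma II_real {a b c : ℂ} (μ : ℂ) (hc : ∀ n : ℕ, c ≠ -(n : ℂ)) {x : ℝ} (hx : x < 1) :
    ∫ y in Iio x, ((1 - y : ℝ) : ℂ) ^ (a + b - c) * hypF a b c y * ((x - y : ℝ) : ℂ) ^ (μ - 1) =
      II a b c μ x := by
  have h := integral_image_eq_integral_abs_deriv_smul (s := Ioi (0:ℝ)) (f := fun t => x - t)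
    (f' := fun _ => -1) measurableSet_Ioi
    (fun t _ => ((hasDerivAt_id t).const_sub x).hasDerivWithinAt)
    (fun s _ t _ h => by simpa using h)
    (fun y : ℝ => ((1 - y : ℝ) : ℂ) ^ (a + b - c) * hypF a b c y * ((x - y : ℝ) : ℂ) ^ (μ - 1))
  have hi : (fun t : ℝ => x - t) '' Ioi 0 = Iio x := by simp
  rw [hi] at h
  rw [h, II]
  refine setIntegral_congr_fun measurableSet_Ioi fun t ht => ?_
  have ht' : 0 < t := ht
  simp only [abs_neg, abs_one, one_smul, sub_sub_cancel, GG]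
  rw [hypF_eq hc (by linarith)]
  push_cast
  rfl

/-- Fractional integral transformation of type `c-`. -/
theorem stmt_7 (a b c μ : ℂ) (hca : μ.re < (c - a).re) (hcb : μ.re < (c - b).re)
    (hμ : 0 < μ.re)
    (hc1 : ∀ n : ℕ, c ≠ -(n : ℂ)) (hc2 : ∀ n : ℕ, c - μ ≠ -(n : ℂ))
    (x : ℝ) (hx : x < 1) :
    ∫ y in Iio x,
        ((1 - y : ℝ) : ℂ) ^ (a + b - c) * hypF a b c y *
          (((x - y : ℝ) : ℂ) ^ (μ - 1) / Complex.Gamma μ)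
      = Complex.Gamma (c - a - μ) / Complex.Gamma (c - a) *
        (Complex.Gamma (c - b - μ) / Complex.Gamma (c - b)) *
        (Complex.Gamma c / Complex.Gamma (c - μ)) *
        ((1 - x : ℝ) : ℂ) ^ (a + b - c + μ) * hypF a b (c - μ) x := by
  have hΓ : Complex.Gamma μ ≠ 0 := Gamma_ne_zero_of_re_pos hμ
  set K : ℂ := Complex.Gamma (c - a - μ) / Complex.Gamma (c - a) *
        (Complex.Gamma (c - b - μ) / Complex.Gamma (c - b)) *
        (Complex.Gamma c / Complex.Gamma (c - μ)) with hK
  set R : ℂ → ℂ := fun y => Complex.Gamma μ * K * ((1 - y) ^ (a + b - c + μ) * Ff a b (c - μ) y) with hR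
  have hRd : DifferentiableOn ℂ R UU := ((pre_diff _).mul (Ff_diff hc2)).const_mul _
  have hneg : ∀ y : ℝ, y < 0 → II a b c μ y = R y := by
    intro y hy
    rw [← II_real μ hc1 (by linarith), main_x hca hcb hμ hc1 hc2 y hy, hypF_eq hc2 (by linarith)]
    simp only [hR, hK]
    push_cast
    rfl
  have heq : EqOn (II a b c μ) R UU := by
    refine ((II_diff hca hcb hμ hc1).analyticOnNhd UU_open).eqOn_of_preconnected_of_frequently_eq
      (hRd.analyticOnNhd UU_open) UU_preconn (z₀ := ((-1 : ℝ) : ℂ)) (UU_real (by norm_num)) ?_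
    have ht : Tendsto (fun y : ℝ => (y : ℂ)) (𝓝[≠] (-1)) (𝓝[≠] ((-1 : ℝ) : ℂ)) := by
      refine tendsto_nhdsWithin_of_tendsto_nhds_of_eventually_within _
        (continuous_ofReal.continuousAt.tendsto.mono_left nhdsWithin_le_nhds) ?_
      filter_upwards [self_mem_nhdsWithin] with y hy
      simpa using fun h : (y : ℂ) = -1 => hy (by exact_mod_cast h)
    refine ht.frequently (Eventually.frequently ?_)
    filter_upwards [nhdsWithin_le_nhds (Iio_mem_nhds (show (-1 : ℝ) < 0 by norm_num))] with y hy
    exact hneg y hy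
  have h1 := heq (UU_real hx)
  rw [← II_real μ hc1 hx] at h1
  simp only [← mul_div_assoc]
  rw [integral_div, h1, hypF_eq hc2 hx]
  simp only [hR]
  push_cast
  field_simp
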